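/- Let {j_1,…,j_t} ⊆ {1,…,n}, (a_1,…,a_t) ∈ ℕ^t, let I ⊆ K{y_1,…,y_n} be a pure binomial σ-ideal, and set I_0 := N^{a_1…a_t}_{j_1…j_t}(I). Assume that ⟨I_0 ∪ {y_{j_1}^{x^{a_1}},…,y_{j_t}^{x^{a_t}}}⟩_r is quasi-normal. Then there exist l ∈ ℕ and pairs (p_k, b_k) for 1 ≤ k ≤ l, with either p_k ∉ {j_1,…,j_t}, or p_k = j_m and b_k < a_m for some m, such that ⟨I ∪ {y_{j_1}^{x^{a_1}},…,y_{j_t}^{x^{a_t}}}⟩_r = ⟨I_0 ∪ {y_{j_1}^{x^{a_1}},…,y_{j_t}^{x^{a_t}}}⟩_r ∩ ⋂_{1≤k≤l} ⟨I ∪ {y_{j_1}^{x^{a_1}},…,y_{j_t}^{x^{a_t}}, y_{p_k}^{x^{b_k}}}⟩_r. -/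

import Mathlib

open Polynomial

section SigmaRing

variable {R : Type*} [CommRing R]

/-- A σ-ideal: an ideal closed under the difference operator σ. -/
def IsSigmaIdeal (σ : R →+* R) (I : Ideal R) : Prop := ∀ a ∈ I, σ a ∈ I

/-- A σ-ideal is well-mixed if `a * b ∈ I` implies `a * σ b ∈ I`. -/
def IsWellMixed (σ : R →+* R) (I : Ideal R) : Prop := ∀ a b : R, a * b ∈ I → a * σ b ∈ I

/-- `[F]`, the smallest σ-ideal containing `F`. -/
def sigmaIdealGen (σ : R →+* R) (F : Set R) : Ideal R :=
  sInf {I : Ideal R | F ⊆ I ∧ IsSigmaIdeal σ I}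

/-- `⟨F⟩`, the smallest well-mixed σ-ideal containing `F` (well-mixed closure). -/
def wmClosure (σ : R →+* R) (F : Set R) : Ideal R :=
  sInf {I : Ideal R | F ⊆ I ∧ IsSigmaIdeal σ I ∧ IsWellMixed σ I}

/-- `⟨F⟩_r`, the smallest radical well-mixed σ-ideal containing `F`. -/
def rwmClosure (σ : R →+* R) (F : Set R) : Ideal R :=
  sInf {I : Ideal R | F ⊆ I ∧ IsSigmaIdeal σ I ∧ IsWellMixed σ I ∧ I.IsRadical}

/-- Symbolic exponent: for `p = Σ c_i x^i ∈ ℕ[x]`, `a^p = Π (σ^i a)^(c_i)`. -/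
noncomputable def sexp (σ : R →+* R) (a : R) (p : Polynomial ℕ) : R :=
  ∏ i ∈ Finset.range (p.natDegree + 1), ((⇑σ)^[i] a) ^ (p.coeff i)

/-- `I` is finitely generated as a radical well-mixed σ-ideal. -/
def FinGenAsRWM (σ : R →+* R) (I : Ideal R) : Prop :=
  ∃ G : Set R, G.Finite ∧ G ⊆ (I : Set R) ∧ I = rwmClosure σ G

/-- σ-prime: a reflexive σ-ideal which is prime. -/
def IsSigmaPrime (σ : R →+* R) (I : Ideal R) : Prop :=
  IsSigmaIdeal σ I ∧ (∀ a : R, σ a ∈ I → a ∈ I) ∧ I.IsPrime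

end SigmaRing

/-- The σ-polynomial ring `K{y_1,…,y_n}`: polynomials in variables `y_i^{x^j}`,
indexed by pairs `(i, j) ∈ Fin n × ℕ`. -/
abbrev DPoly (K : Type*) [Field K] (n : ℕ) := MvPolynomial (Fin n × ℕ) K

section DPoly

variable {K : Type*} [Field K] {n : ℕ} (σK : K →+* K)

/-- The difference operator on `K{y_1,…,y_n}` extending `σK`, with `σ(y_i^{x^j}) = y_i^{x^{j+1}}`. -/
noncomputable def shift : DPoly K n →+* DPoly K n :=
  MvPolynomial.eval₂Hom ((MvPolynomial.C : K →+* DPoly K n).comp σK)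
    (fun v => MvPolynomial.X (v.1, v.2 + 1))

/-- `y_i^p` for `p ∈ ℕ[x]`. -/
noncomputable def ypow (i : Fin n) (p : Polynomial ℕ) : DPoly K n :=
  sexp (shift σK) (MvPolynomial.X (i, 0)) p

/-- `y_i^{x^a}`. -/
noncomputable def varPow (i : Fin n) (a : ℕ) : DPoly K n :=
  ypow σK i (Polynomial.X ^ a)

/-- The monomial `Y^f = Π y_i^{f_i}` for `f ∈ ℕ[x]^n`. -/
noncomputable def monom (f : Fin n → Polynomial ℕ) : DPoly K n :=
  ∏ i, ypow σK i (f i)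

/-- A pure binomial `Y^f − Y^g`. -/
def IsPureBinomial (p : DPoly K n) : Prop :=
  ∃ f g : Fin n → Polynomial ℕ, p = monom σK f - monom σK g

/-- A binomial `a·Y^f + b·Y^g` with `a, b ∈ K^×`. -/
def IsBinomial (p : DPoly K n) : Prop :=
  ∃ (a b : K) (f g : Fin n → Polynomial ℕ), a ≠ 0 ∧ b ≠ 0 ∧
    p = MvPolynomial.C a * monom σK f + MvPolynomial.C b * monom σK g

/-- A pure binomial σ-ideal: a σ-ideal generated by pure binomials. -/
def IsPureBinomialSigmaIdeal (I : Ideal (DPoly K n)) : Prop :=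
  ∃ S : Set (DPoly K n), (∀ p ∈ S, IsPureBinomial σK p) ∧ I = sigmaIdealGen (shift σK) S

/-- Positive part of `f ∈ ℤ[x]`. -/
noncomputable def posPart (f : Polynomial ℤ) : Polynomial ℕ :=
  f.sum fun i c => Polynomial.monomial i c.toNat

/-- Negative part of `f ∈ ℤ[x]`. -/
noncomputable def negPart (f : Polynomial ℤ) : Polynomial ℕ :=
  f.sum fun i c => Polynomial.monomial i (-c).toNat

/-- The lattice σ-ideal `I_L = [Y^{f_+} − Y^{f_−} : f ∈ L]` of a ℤ[x]-lattice `L ⊆ ℤ[x]^n`. -/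
noncomputable def latticeIdeal (L : Submodule (Polynomial ℤ) (Fin n → Polynomial ℤ)) :
    Ideal (DPoly K n) :=
  sigmaIdealGen (shift σK)
    {p | ∃ f ∈ L, p = monom σK (fun i => posPart (f i)) - monom σK (fun i => negPart (f i))}

end DPoly

/-- `𝔪`: the multiplicatively closed set generated by the variables `y_i^{x^j}`. -/
def mSet (K : Type*) [Field K] (n : ℕ) : Set (DPoly K n) :=
  (Submonoid.closure (Set.range fun v : Fin n × ℕ => (MvPolynomial.X v : DPoly K n)) : Set _)

/-- `I : 𝔪 = {p : M p ∈ I for some M ∈ 𝔪}`. -/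
def colonM {K : Type*} [Field K] {n : ℕ} (I : Ideal (DPoly K n)) : Set (DPoly K n) :=
  {p | ∃ M ∈ mSet K n, M * p ∈ I}

section Tsec

variable {K : Type*} [Field K] {n t : ℕ} (σK : K →+* K)

/-- The set `T^{a_1…a_t}_{j_1…j_t}` of monomials `Y^f` with `deg f_{j_i} < a_i`. -/
def Tset (j : Fin t → Fin n) (a : Fin t → ℕ) : Set (DPoly K n) :=
  {p | ∃ f : Fin n → Polynomial ℕ,
    (∀ i : Fin t, (f (j i)).degree < (a i : WithBot ℕ)) ∧ p = monom σK f}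

/-- `I` is saturated with respect to `{y_{j_1}^{x^{a_1}},…,y_{j_t}^{x^{a_t}}}`. -/
def SaturatedWrt (j : Fin t → Fin n) (a : Fin t → ℕ) (I : Ideal (DPoly K n)) : Prop :=
  ∀ g M : DPoly K n, M ∈ Tset σK j a → M * g ∈ I → g ∈ I

/-- `J : T = {g : M g ∈ J for some M ∈ T}`. -/
def colonT (j : Fin t → Fin n) (a : Fin t → ℕ) (J : Ideal (DPoly K n)) : Set (DPoly K n) :=
  {g | ∃ M ∈ Tset σK j a, M * g ∈ J}

/-- The `T`-saturated closure `N^{a_1…a_t}_{j_1…j_t}(I)`: the smallest saturated σ-ideal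
containing `I`. -/
noncomputable def Nclosure (j : Fin t → Fin n) (a : Fin t → ℕ) (I : Ideal (DPoly K n)) :
    Ideal (DPoly K n) :=
  sInf {J : Ideal (DPoly K n) | I ≤ J ∧ IsSigmaIdeal (shift σK) J ∧ SaturatedWrt σK j a J}

/-- The set of variables `{y_{j_1}^{x^{a_1}},…,y_{j_t}^{x^{a_t}}}`. -/
noncomputable def varSet (j : Fin t → Fin n) (a : Fin t → ℕ) : Set (DPoly K n) :=
  Set.range fun i => varPow σK (j i) (a i)

/-- `⟨I₀ ∪ {y_{j_1}^{x^{a_1}},…,y_{j_t}^{x^{a_t}}}⟩_r` is quasi-normal. -/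
def QuasiNormal (j : Fin t → Fin n) (a : Fin t → ℕ) (I0 : Ideal (DPoly K n)) : Prop :=
  SaturatedWrt σK j a I0 ∧
  ∀ f g : Fin n → Polynomial ℕ, monom σK f - monom σK g ∈ I0 →
    monom σK f ∈ sigmaIdealGen (shift σK) (varSet σK j a) →
    monom σK g ∈ sigmaIdealGen (shift σK) (varSet σK j a)

end Tsec


/-- A Ramsey statement for finitely many transitive relations: if any two terms are related by one
of them, then a single one relates all pairs of some subsequence. -/
theorem exists_subseq_of_transitive_relations {ι : Type*} [Finite ι] (R : ι → ℕ → ℕ → Prop)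
    (htrans : ∀ i, IsTrans ℕ (R i)) (h : ∀ s r, s < r → ∃ i, R i s r) :
    ∃ i, ∃ φ : ℕ ↪o ℕ, ∀ s r, s < r → R i (φ s) (φ r) := by
  classical
  have := Fintype.ofFinite ι
  suffices H : ∀ (T : Finset ι) (φ : ℕ ↪o ℕ),
      (∀ s r, s < r → ∃ i ∈ T, R i (φ s) (φ r)) →
      ∃ i, ∃ ψ : ℕ ↪o ℕ, ∀ s r, s < r → R i (ψ s) (ψ r) from
    H Finset.univ (RelEmbedding.refl _) fun s r hsr => by simpa using h s r hsr
  intro T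
  induction T using Finset.induction_on with
  | empty =>
    intro φ hφ
    obtain ⟨i, hi, -⟩ := hφ 0 1 one_pos
    simp at hi
  | insert i T _ ih =>
    intro φ hφ
    have := htrans i
    obtain ⟨ψ, hψ | hψ⟩ := exists_increasing_or_nonincreasing_subseq (R i) φ
    · exact ⟨i, ψ.trans φ, hψ⟩
    · refine ih (ψ.trans φ) fun s r hsr => ?_
      obtain ⟨k, hk, hR⟩ := hφ _ _ (ψ.lt_iff_lt.2 hsr)
      rcases Finset.mem_insert.1 hk with rfl | hT
      · exact absurd hR (hψ s r hsr)
      · exact ⟨k, hT, hR⟩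

/-- In a sequence of integers, some term is in the subgroup generated by the preceding ones. -/
theorem exists_mem_span_image_Iio (z : ℕ → ℤ) : ∃ r, z r ∈ Submodule.span ℤ (z '' Set.Iio r) := by
  obtain ⟨N, hN⟩ := monotone_stabilizes_iff_noetherian.2 (inferInstance : IsNoetherian ℤ ℤ)
    ⟨fun r => Submodule.span ℤ (z '' Set.Iio r), fun a b hab =>
      Submodule.span_mono (Set.image_mono (Set.Iio_subset_Iio hab))⟩
  refine ⟨N, ?_⟩
  have h : Submodule.span ℤ (z '' Set.Iio N) = Submodule.span ℤ (z '' Set.Iio (N + 1)) :=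
    hN (N + 1) N.le_succ
  exact h ▸ Submodule.subset_span ⟨N, Nat.lt_succ_self N, rfl⟩

/-- A vector of polynomials avoiding the set `Z` of positions. -/
def Avoids {A : Type*} [Semiring A] {n : ℕ} (Z : Fin n → ℕ → Prop) (f : Fin n → A[X]) : Prop :=
  ∀ i b, Z i b → (f i).coeff b = 0

section FiniteDetermination

variable {n : ℕ}

/-- The abstract properties of the pairs `(Z, ok)` attached to the `σ`-stable prime ideals `P`:
`Z` is the set of variables in `P` and `ok` is the set of exponent vectors `f` such that
`Y^{f_+} - Y^{f_-}` belongs to `P`. -/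
structure IsPattern (Z : Fin n → ℕ → Prop) (ok : (Fin n → ℤ[X]) → Prop) : Prop where
  mono : ∀ i b c, b ≤ c → Z i b → Z i c
  zero : ok 0
  neg : ∀ f, ok f → ok (-f)
  add : ∀ f h, ok f → ok h → Avoids Z h → ok (f + h)
  shift : ∀ f (k : ℕ), ok f → ok fun i => X ^ k * f i
  avoids : ∀ f, ok f → (∀ i b, Z i b → 0 ≤ (f i).coeff b) → Avoids Z f
  signed : ∀ f, ¬ ok f →
    (∀ i b, Z i b → 0 ≤ (f i).coeff b) ∨ ∀ i b, Z i b → (f i).coeff b ≤ 0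

namespace IsPattern

theorem avoids_of_signed {Z : Fin n → ℕ → Prop} {ok : (Fin n → ℤ[X]) → Prop} (hP : IsPattern Z ok)
    {f : Fin n → ℤ[X]} (hf : ok f)
    (h : (∀ i b, Z i b → 0 ≤ (f i).coeff b) ∨ ∀ i b, Z i b → (f i).coeff b ≤ 0) : Avoids Z f := by
  rcases h with h | h
  · exact hP.avoids f hf h
  · intro i b hb
    have := hP.avoids (-f) (hP.neg f hf) (fun i b hb => by simpa using h i b hb) i b hb
    simpa using this

/-- The position used to compare `f` in the coordinate `i`: the first position of `Z` if `f i` meets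
`Z`, and the degree of `f i` otherwise. -/
noncomputable def cut (Z : Fin n → ℕ → Prop) (f : Fin n → ℤ[X]) (i : Fin n) : ℕ :=
  open Classical in if ∃ b, Z i b ∧ (f i).coeff b ≠ 0 then sInf {b | Z i b} else (f i).natDegree

theorem mem_of_shift_mem {Z : Fin n → ℕ → Prop} {ok : (Fin n → ℤ[X]) → Prop}
    (hP : IsPattern Z ok) {Z' : Fin n → ℕ → Prop} {ok' : (Fin n → ℤ[X]) → Prop}
    (hP' : IsPattern Z' ok') {f f' : Fin n → ℤ[X]}
    (hsupp : ∀ i, f i = 0 ↔ f' i = 0)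
    (hmeet : ∀ i, (∃ b, Z i b ∧ (f i).coeff b ≠ 0) ↔ ∃ b, Z' i b ∧ (f' i).coeff b ≠ 0)
    {k : ℕ} (hk : ∀ i, f i ≠ 0 → cut Z f i + k ≤ cut Z' f' i)
    {i : Fin n} {b : ℕ} (hb : Z' i (b + k)) (hne : (f i).coeff b ≠ 0) : Z i b := by
  have hfi : f i ≠ 0 := fun h => hne (by simp [h])
  have hki := hk i hfi
  unfold cut at hki
  by_cases hB : ∃ b, Z i b ∧ (f i).coeff b ≠ 0
  · rw [if_pos hB, if_pos ((hmeet i).1 hB)] at hki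
    have h1 : sInf {b | Z' i b} ≤ b + k := Nat.sInf_le hb
    obtain ⟨b₀, hb₀, -⟩ := hB
    exact hP.mono i _ _ (by omega) (Nat.sInf_mem (s := {b | Z i b}) ⟨b₀, hb₀⟩)
  · rw [if_neg hB, if_neg (mt (hmeet i).2 hB)] at hki
    have h1 : b ≤ (f i).natDegree := le_natDegree_of_ne_zero hne
    refine absurd ⟨(f' i).natDegree, hP'.mono i _ _ (by omega) hb, ?_⟩ (mt (hmeet i).2 hB)
    exact leadingCoeff_ne_zero.2 (mt (hsupp i).2 hfi)

end IsPattern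

open IsPattern in
/-- The vectors of a subgroup `L` that are relevant for a family of patterns are determined by a
finite part of `L`. -/
theorem exists_finite_determining_set {ι : Type*} (Z : ι → Fin n → ℕ → Prop)
    (ok : ι → (Fin n → ℤ[X]) → Prop) (hP : ∀ p, IsPattern (Z p) (ok p))
    (L : AddSubgroup (Fin n → ℤ[X]))
    (hL : ∀ p, ∀ f ∈ L, ∀ k : ℕ, Avoids (Z p) (fun i => X ^ k * f i) →
      (fun i => X ^ k * f i) ∈ L) :
    ∃ G : Finset (Fin n → ℤ[X]), (↑G ⊆ (L : Set (Fin n → ℤ[X]))) ∧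
      ∀ p, (∀ g ∈ G, ok p g) → ∀ f ∈ L, ok p f := by
  classical
  by_contra hcon
  push Not at hcon
  obtain ⟨u, hu, hur⟩ := exists_seq_of_forall_finset_exists
    (fun x : ι × (Fin n → ℤ[X]) => x.2 ∈ L ∧ ¬ ok x.1 x.2 ∧
      ∀ g ∈ L, (fun i => (g i).degree) < (fun i => (x.2 i).degree) → ok x.1 g)
    (fun x y => ok y.1 x.2) (by
      intro s hs
      obtain ⟨p, hp, f, hfL, hf⟩ := hcon (s.image Prod.snd) (by
        intro f hf
        simp only [Finset.coe_image, Set.mem_image] at hf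
        obtain ⟨x, hx, rfl⟩ := hf
        exact (hs x hx).1)
      obtain ⟨f₀, ⟨hf₀L, hf₀⟩, hmin⟩ := WellFounded.has_min
        (InvImage.wf (fun (g : Fin n → ℤ[X]) i => (g i).degree)
          (wellFounded_lt (α := Fin n → WithBot ℕ))) {g | g ∈ L ∧ ¬ ok p g} ⟨f, hfL, hf⟩
      refine ⟨(p, f₀), ⟨hf₀L, hf₀, fun g hg hlt => ?_⟩, fun x hx =>
        hp _ (Finset.mem_image_of_mem _ hx)⟩
      by_contra hgok
      exact hmin g ⟨hg, hgok⟩ hlt)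
  -- a subsequence on which the zero coordinates and the coordinates meeting `Z` are constant
  obtain ⟨⟨S, B⟩, hSB⟩ := Finite.exists_infinite_fiber
    (fun r => (({i | (u r).2 i = 0} : Set (Fin n)),
      ({i | ∃ b, Z (u r).1 i b ∧ ((u r).2 i).coeff b ≠ 0} : Set (Fin n))))
  set W : Set ℕ := (fun r => (({i | (u r).2 i = 0} : Set (Fin n)),
      ({i | ∃ b, Z (u r).1 i b ∧ ((u r).2 i).coeff b ≠ 0} : Set (Fin n)))) ⁻¹' {(S, B)} with hW
  have hconst : ∀ r, (∀ i, (u (Nat.orderEmbeddingOfSet W r)).2 i = 0 ↔ i ∈ S) ∧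
      ∀ i, (∃ b, Z (u (Nat.orderEmbeddingOfSet W r)).1 i b ∧
        ((u (Nat.orderEmbeddingOfSet W r)).2 i).coeff b ≠ 0) ↔ i ∈ B := by
    intro r
    have h : Nat.orderEmbeddingOfSet W r ∈ W :=
      (Nat.orderEmbeddingOfSet_range W).subset ⟨r, rfl⟩
    simp only [hW, Set.mem_preimage, Set.mem_singleton_iff, Prod.mk.injEq, Set.ext_iff] at h
    exact h
  generalize Nat.orderEmbeddingOfSet W = φ at hconst
  -- a subsequence on which the cuts are monotone
  obtain ⟨ψ, hψ⟩ := (wellQuasiOrdered_le (α := Fin n → ℕ)).exists_monotone_subseq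
    (fun r => cut (Z (u (φ r)).1) (u (φ r)).2)
  set m : ℕ → Fin n → ℕ := fun r => cut (Z (u (φ (ψ r))).1) (u (φ (ψ r))).2 with hm
  have hSne : ∃ i, i ∉ S := by
    by_contra! hall
    apply (hu (φ 0)).2.1
    have : (u (φ 0)).2 = 0 := funext fun i => ((hconst 0).1 i).2 (hall i)
    rw [this]
    exact (hP _).zero
  -- a subsequence on which the increment of the cuts is minimal in a constant coordinate
  obtain ⟨⟨i₀, hi₀⟩, χ, hχ⟩ := exists_subseq_of_transitive_relations
    (ι := {i : Fin n // i ∉ S})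
    (fun i s r => ∀ i', i' ∉ S → m r i + m s i' ≤ m r i' + m s i)
    (fun i => ⟨fun a b c hab hbc i' hi' => by
      have h1 := hab i' hi'
      have h2 := hbc i' hi'
      omega⟩)
    (fun s r hsr => by
      obtain ⟨i, hi, hmin⟩ := Finset.exists_min_image (Finset.univ.filter (· ∉ S))
        (fun i => (m r i : ℤ) - m s i) (by
          obtain ⟨i, hi⟩ := hSne
          exact ⟨i, by simpa using hi⟩)
      refine ⟨⟨i, by simpa using hi⟩, fun i' hi' => ?_⟩
      have := hmin i' (by simpa using hi')
      simp only
      omega)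
  set P : ℕ → ι := fun r => (u (φ (ψ (χ r)))).1 with hPdef
  set f : ℕ → Fin n → ℤ[X] := fun r => (u (φ (ψ (χ r)))).2 with hfdef
  have hfL : ∀ r, f r ∈ L := fun r => (hu _).1
  have hfnot : ∀ r, ¬ ok (P r) (f r) := fun r => (hu _).2.1
  have hfmin : ∀ r, ∀ g ∈ L, (fun i => (g i).degree) < (fun i => (f r i).degree) → ok (P r) g :=
    fun r => (hu _).2.2
  have hfok : ∀ s r, s < r → ok (P r) (f s) := fun s r hsr =>
    hur _ _ (φ.lt_iff_lt.2 (ψ.lt_iff_lt.2 (χ.lt_iff_lt.2 hsr)))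
  have hfS : ∀ r i, f r i = 0 ↔ i ∈ S := fun r i => (hconst _).1 i
  have hfB : ∀ r i, (∃ b, Z (P r) i b ∧ (f r i).coeff b ≠ 0) ↔ i ∈ B := fun r i => (hconst _).2 i
  have hmono : ∀ s r, s < r → ∀ i, cut (Z (P s)) (f s) i ≤ cut (Z (P r)) (f r) i :=
    fun s r hsr i => hψ _ _ (χ.lt_iff_lt.2 hsr).le i
  have hcut : ∀ s r, s < r → ∀ i, i ∉ S →
      cut (Z (P s)) (f s) i + (cut (Z (P r)) (f r) i₀ - cut (Z (P s)) (f s) i₀) ≤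
        cut (Z (P r)) (f r) i := by
    intro s r hsr i hi
    have h1 := hχ s r hsr i hi
    have h2 := hmono s r hsr i₀
    simp only [hm] at h1
    simp only [hPdef, hfdef] at h2 ⊢
    omega
  clear_value P f
  clear hχ hm hψ hconst hu hur hSB hSne
  -- the shifts of earlier terms that are used to reduce `f r`
  have hav : ∀ s r, s < r → Avoids (Z (P r))
      (fun i => X ^ (cut (Z (P r)) (f r) i₀ - cut (Z (P s)) (f s) i₀) * f s i) := by
    intro s r hsr
    refine (hP (P r)).avoids_of_signed ((hP _).shift _ _ (hfok s r hsr)) ?_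
    have key : ∀ i b, Z (P r) i (b + (cut (Z (P r)) (f r) i₀ - cut (Z (P s)) (f s) i₀)) →
        (f s i).coeff b ≠ 0 → Z (P s) i b := fun i b =>
      (hP (P s)).mem_of_shift_mem (hP (P r)) (fun i => (hfS s i).trans (hfS r i).symm)
        (fun i => (hfB s i).trans (hfB r i).symm)
        (fun i hi => hcut s r hsr i (mt (hfS s i).2 hi))
    refine ((hP (P s)).signed _ (hfnot s)).imp ?_ ?_ <;>
    · intro h i b hb
      rw [coeff_X_pow_mul']
      split_ifs with hkb
      · by_cases h0 : (f s i).coeff (b - (cut (Z (P r)) (f r) i₀ - cut (Z (P s)) (f s) i₀)) = 0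
        · rw [h0]
        · exact h i _ (key i _ (by rwa [Nat.sub_add_cancel hkb]) h0)
      · exact le_rfl
  have hi₀B : i₀ ∉ B := by
    intro hB
    obtain ⟨b, hb, hne⟩ := (hfB 0 i₀).2 hB
    obtain ⟨b', hb', -⟩ := (hfB 1 i₀).2 hB
    have h1 := hmono 0 1 one_pos i₀
    have h2 : cut (Z (P 0)) (f 0) i₀ ≤ b := by
      rw [cut, if_pos ((hfB 0 i₀).2 hB)]
      exact Nat.sInf_le hb
    have h3 : Z (P 1) i₀ (cut (Z (P 1)) (f 1) i₀) := by
      rw [cut, if_pos ((hfB 1 i₀).2 hB)]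
      exact Nat.sInf_mem (s := {b | Z (P 1) i₀ b}) ⟨b', hb'⟩
    have h4 := hav 0 1 one_pos i₀
      (b + (cut (Z (P 1)) (f 1) i₀ - cut (Z (P 0)) (f 0) i₀))
      ((hP _).mono i₀ _ _ (by omega) h3)
    rw [coeff_X_pow_mul] at h4
    exact hne h4
  have hcutdeg : ∀ r i, i ∉ B → cut (Z (P r)) (f r) i = (f r i).natDegree := fun r i hi => by
    rw [cut, if_neg (mt (hfB r i).1 hi)]
  have hdeg : ∀ s r, s < r → ∀ i,
      (X ^ (cut (Z (P r)) (f r) i₀ - cut (Z (P s)) (f s) i₀) * f s i).degree ≤ (f r i).degree := by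
    intro s r hsr i
    by_cases hiS : i ∈ S
    · simp [(hfS s i).2 hiS, (hfS r i).2 hiS]
    rw [degree_eq_natDegree (mt (hfS r i).1 hiS)]
    refine (degree_le_iff_coeff_zero _ _).2 fun b hb => ?_
    have hb : (f r i).natDegree < b := by exact_mod_cast hb
    by_cases hiB : i ∈ B
    · obtain ⟨b', hb', hne⟩ := (hfB r i).2 hiB
      exact hav s r hsr i b ((hP _).mono i _ _ ((le_natDegree_of_ne_zero hne).trans hb.le) hb')
    · have h := hcut s r hsr i hiS
      rw [hcutdeg s i hiB, hcutdeg r i hiB] at h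
      rw [coeff_X_pow_mul']
      split_ifs with hkb
      · exact coeff_eq_zero_of_natDegree_lt (by omega)
      · rfl
  obtain ⟨r, hr⟩ := exists_mem_span_image_Iio fun r => (f r i₀).leadingCoeff
  let Q : AddSubgroup ℤ :=
    { carrier := {z | ∃ h ∈ L, ok (P r) h ∧ Avoids (Z (P r)) h ∧
        (∀ i, (h i).degree ≤ (f r i).degree) ∧ (h i₀).coeff (f r i₀).natDegree = z}
      zero_mem' := ⟨0, L.zero_mem, (hP _).zero, fun i b _ => by simp, fun i => by simp, by simp⟩
      add_mem' := by
        rintro _ _ ⟨g, hgL, hg, hgZ, hgd, rfl⟩ ⟨h, hhL, hh, hhZ, hhd, rfl⟩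
        refine ⟨g + h, L.add_mem hgL hhL, (hP _).add _ _ hg hh hhZ, fun i b hb => ?_, fun i => ?_, ?_⟩
        · simp [hgZ i b hb, hhZ i b hb]
        · exact (degree_add_le _ _).trans (max_le (hgd i) (hhd i))
        · simp
      neg_mem' := by
        rintro _ ⟨g, hgL, hg, hgZ, hgd, rfl⟩
        refine ⟨-g, L.neg_mem hgL, (hP _).neg _ hg, fun i b hb => ?_, fun i => ?_, ?_⟩
        · simp [hgZ i b hb]
        · simpa using hgd i
        · simp }
  have hQ : (f r i₀).leadingCoeff ∈ AddSubgroup.toIntSubmodule Q := by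
    refine Submodule.span_le.2 ?_ hr
    rintro _ ⟨s, hsr, rfl⟩
    refine ⟨_, hL (P r) _ (hfL s) _ (hav s r hsr), (hP _).shift _ _ (hfok s r hsr), hav s r hsr,
      hdeg s r hsr, ?_⟩
    have h := hmono s r hsr i₀
    rw [hcutdeg s i₀ hi₀B, hcutdeg r i₀ hi₀B] at h ⊢
    rw [coeff_X_pow_mul', if_pos (by omega), Nat.sub_sub_self h]
    rfl
  obtain ⟨h, hhL, hh, hhZ, hhd, hlc⟩ := hQ
  refine hfnot r ?_
  have hsub : ok (P r) (f r - h) := by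
    refine hfmin r _ (L.sub_mem (hfL r) hhL) (Pi.lt_def.2 ⟨fun i => ?_, i₀, ?_⟩)
    · exact (degree_sub_le _ _).trans (max_le le_rfl (hhd i))
    · have hne : f r i₀ ≠ 0 := mt (hfS r i₀).1 hi₀
      rw [degree_eq_natDegree hne]
      refine (degree_lt_iff_coeff_zero _ _).2 fun b hb => ?_
      rcases hb.eq_or_lt with rfl | hb
      · simp [hlc]
      · have hb' : (f r i₀).degree < b := by
          rw [degree_eq_natDegree hne]
          exact_mod_cast hb
        simp [coeff_eq_zero_of_degree_lt hb', coeff_eq_zero_of_degree_lt ((hhd i₀).trans_lt hb')]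
  simpa using (hP _).add _ _ hsub hh hhZ

end FiniteDetermination

section Prime

variable {R : Type*} [CommRing R]

theorem Ideal.exists_notMem_mul_mem_of_mem_minimalPrimes {I P : Ideal R} (hI : I.IsRadical)
    (hP : P ∈ I.minimalPrimes) {x : R} (hx : x ∈ P) : ∃ s ∉ P, s * x ∈ I := by
  have hprime : P.IsPrime := hP.1.1
  by_contra! hcon
  have hdisj : Disjoint (I : Set R) (P.primeCompl ⊔ Submonoid.powers x : Submonoid R) := by
    rw [Set.disjoint_left]
    rintro y hy hyM
    obtain ⟨s, hs, z, ⟨k, rfl⟩, rfl⟩ := Submonoid.mem_sup.1 hyM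
    refine hcon s hs (hI ⟨k + 1, ?_⟩)
    have : (s * x) ^ (k + 1) = s ^ k * x * (s * x ^ k) := by ring
    rw [this]
    exact I.mul_mem_left _ hy
  obtain ⟨Q, hQ, hIQ, hQM⟩ := Ideal.exists_le_prime_disjoint I _ hdisj
  have hQP : Q ≤ P := fun y hy => by
    by_contra hyP
    exact Set.disjoint_left.1 hQM hy ((le_sup_left : P.primeCompl ≤ _) hyP)
  exact Set.disjoint_left.1 hQM (hP.2 ⟨hQ, hIQ⟩ hQP hx)
    ((le_sup_right : Submonoid.powers x ≤ P.primeCompl ⊔ Submonoid.powers x)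
      (Submonoid.mem_powers x))

theorem IsWellMixed.isSigmaIdeal_of_mem_minimalPrimes {σ : R →+* R} {I P : Ideal R}
    (hwm : IsWellMixed σ I) (hI : I.IsRadical) (hP : P ∈ I.minimalPrimes) : IsSigmaIdeal σ P := by
  intro x hx
  obtain ⟨s, hs, hsx⟩ := Ideal.exists_notMem_mul_mem_of_mem_minimalPrimes hI hP hx
  exact (hP.1.1.mem_or_mem (hP.1.2 (hwm s x hsx))).resolve_left hs

variable (σ : R →+* R)

theorem subset_rwmClosure (F : Set R) : F ⊆ rwmClosure σ F := fun _ hx =>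
  Submodule.mem_sInf.2 fun _ hI => hI.1 hx

theorem rwmClosure_isWellMixed (F : Set R) : IsWellMixed σ (rwmClosure σ F) := fun a b hab =>
  Submodule.mem_sInf.2 fun _ hI => hI.2.2.1 a b (Submodule.mem_sInf.1 hab _ hI)

theorem rwmClosure_isSigmaIdeal (F : Set R) : IsSigmaIdeal σ (rwmClosure σ F) := fun a ha =>
  Submodule.mem_sInf.2 fun _ hI => hI.2.1 a (Submodule.mem_sInf.1 ha _ hI)

theorem rwmClosure_isRadical (F : Set R) : (rwmClosure σ F).IsRadical := fun _ ⟨k, hk⟩ =>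
  Submodule.mem_sInf.2 fun _ hI => hI.2.2.2 ⟨k, Submodule.mem_sInf.1 hk _ hI⟩

theorem rwmClosure_mono {F G : Set R} (h : F ⊆ rwmClosure σ G) : rwmClosure σ F ≤ rwmClosure σ G :=
  sInf_le ⟨h, rwmClosure_isSigmaIdeal σ G, rwmClosure_isWellMixed σ G, rwmClosure_isRadical σ G⟩

theorem rwmClosure_le_of_isPrime {F : Set R} {P : Ideal R} (hP : P.IsPrime)
    (hσ : IsSigmaIdeal σ P) (hF : F ⊆ P) : rwmClosure σ F ≤ P :=
  sInf_le ⟨hF, hσ, fun _ b hab => (hP.mem_or_mem hab).elim (fun h => P.mul_mem_right _ h)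
    fun h => P.mul_mem_left _ (hσ b h), hP.isRadical⟩

/-- The radical well-mixed closure is the intersection of the `σ`-stable primes. -/
theorem mem_rwmClosure_of_forall_isPrime {F : Set R} {x : R}
    (h : ∀ P : Ideal R, P.IsPrime → IsSigmaIdeal σ P → F ⊆ P → x ∈ P) : x ∈ rwmClosure σ F := by
  rw [← (rwmClosure_isRadical σ F).radical, ← Ideal.sInf_minimalPrimes]
  refine Submodule.mem_sInf.2 fun P hP => h P hP.1.1 ?_ fun y hy => hP.1.2 (subset_rwmClosure σ F hy)
  exact (rwmClosure_isWellMixed σ F).isSigmaIdeal_of_mem_minimalPrimes (rwmClosure_isRadical σ F) hP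

theorem subset_sigmaIdealGen (F : Set R) : F ⊆ sigmaIdealGen σ F := fun _ hx =>
  Submodule.mem_sInf.2 fun _ hI => hI.1 hx

theorem IsSigmaIdeal.iterate_mem {σ : R →+* R} {I : Ideal R} (hI : IsSigmaIdeal σ I) {x : R}
    (hx : x ∈ I) (k : ℕ) : (⇑σ)^[k] x ∈ I := by
  induction k with
  | zero => exact hx
  | succ k ih =>
    rw [Function.iterate_succ_apply']
    exact hI _ ih

end Prime

section Monomials

variable {K : Type*} [Field K] {n : ℕ} (σK : K →+* K)

theorem shift_iterate_X (i : Fin n) (k : ℕ) :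
    (⇑(shift σK : DPoly K n →+* DPoly K n))^[k] (MvPolynomial.X (i, 0)) =
      MvPolynomial.X (i, k) := by
  induction k with
  | zero => rfl
  | succ k ih => rw [Function.iterate_succ_apply', ih, shift, MvPolynomial.eval₂Hom_X']

theorem shift_X (i : Fin n) (k : ℕ) : (shift σK : DPoly K n →+* DPoly K n)
    (MvPolynomial.X (i, k)) = MvPolynomial.X (i, k + 1) := by
  simp [shift]

theorem ypow_eq_prod (i : Fin n) (p : ℕ[X]) {N : ℕ} (hN : p.natDegree < N) :
    (ypow σK i p : DPoly K n) =
      ∏ k ∈ Finset.range N, (MvPolynomial.X (i, k) : DPoly K n) ^ p.coeff k := by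
  rw [ypow, sexp]
  simp only [shift_iterate_X]
  refine Finset.prod_subset (by simpa using hN) fun k _ hk => ?_
  rw [coeff_eq_zero_of_natDegree_lt (by simpa using hk), pow_zero]

theorem ypow_zero (i : Fin n) : (ypow σK i 0 : DPoly K n) = 1 := by
  rw [ypow_eq_prod σK i 0 (N := 1) (by simp)]
  simp

theorem ypow_add (i : Fin n) (p q : ℕ[X]) :
    (ypow σK i (p + q) : DPoly K n) = ypow σK i p * ypow σK i q := by
  have hp : p.natDegree < max p.natDegree q.natDegree + 1 := by omega
  have hq : q.natDegree < max p.natDegree q.natDegree + 1 := by omega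
  have hpq : (p + q).natDegree < max p.natDegree q.natDegree + 1 :=
    Nat.lt_succ_of_le (natDegree_add_le p q)
  rw [ypow_eq_prod σK i _ hp, ypow_eq_prod σK i _ hq, ypow_eq_prod σK i _ hpq,
    ← Finset.prod_mul_distrib]
  exact Finset.prod_congr rfl fun k _ => by rw [coeff_add, pow_add]

theorem shift_ypow (i : Fin n) (p : ℕ[X]) :
    shift σK (ypow σK i p : DPoly K n) = ypow σK i (X * p) := by
  rw [ypow_eq_prod σK i p p.natDegree.lt_succ_self, map_prod,
    ypow_eq_prod σK i (X * p) (N := p.natDegree + 1 + 1)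
      (Nat.lt_succ_of_le (natDegree_mul_le.trans (by simp [add_comm]))),
    Finset.prod_range_succ' _ (p.natDegree + 1)]
  simp [shift_X]

theorem varPow_eq_X (i : Fin n) (a : ℕ) : (varPow σK i a : DPoly K n) = MvPolynomial.X (i, a) := by
  rw [varPow, ypow_eq_prod σK i _ (N := a + 1) (by simp)]
  rw [Finset.prod_eq_single a]
  · simp
  · intro b _ hb
    simp [coeff_X_pow, hb]
  · simp

theorem monom_zero : (monom σK 0 : DPoly K n) = 1 := by
  simp [monom, ypow_zero]

theorem monom_add (f g : Fin n → ℕ[X]) :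
    (monom σK (f + g) : DPoly K n) = monom σK f * monom σK g := by
  simp [monom, ypow_add, Finset.prod_mul_distrib]

theorem shift_monom (f : Fin n → ℕ[X]) :
    shift σK (monom σK f : DPoly K n) = monom σK fun i => X * f i := by
  simp [monom, shift_ypow]

theorem shift_iterate_monom (f : Fin n → ℕ[X]) (k : ℕ) :
    (⇑(shift σK))^[k] (monom σK f : DPoly K n) = monom σK fun i => X ^ k * f i := by
  induction k with
  | zero => simp
  | succ k ih =>
    rw [Function.iterate_succ_apply', ih, shift_monom]
    simp only [pow_succ', mul_assoc]

theorem X_dvd_monom {f : Fin n → ℕ[X]} {i : Fin n} {b : ℕ} (h : (f i).coeff b ≠ 0) :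
    (MvPolynomial.X (i, b) : DPoly K n) ∣ monom σK f := by
  refine dvd_trans ?_ (Finset.dvd_prod_of_mem _ (Finset.mem_univ i))
  rw [ypow_eq_prod σK i (f i) (f i).natDegree.lt_succ_self]
  refine dvd_trans (dvd_pow_self _ h) (Finset.dvd_prod_of_mem
    (fun k => (MvPolynomial.X (i, k) : DPoly K n) ^ (f i).coeff k) ?_)
  exact Finset.mem_range.2 (Nat.lt_succ_of_le (le_natDegree_of_ne_zero h))

theorem monom_mem_iff {P : Ideal (DPoly K n)} (hP : P.IsPrime) (f : Fin n → ℕ[X]) :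
    monom σK f ∈ P ↔ ∃ i b, (MvPolynomial.X (i, b) : DPoly K n) ∈ P ∧ (f i).coeff b ≠ 0 := by
  refine ⟨fun h => ?_, fun ⟨i, b, hX, hb⟩ => Ideal.mem_of_dvd _ (X_dvd_monom σK hb) hX⟩
  obtain ⟨i, -, hi⟩ := hP.prod_mem_iff.1 h
  rw [ypow_eq_prod σK i (f i) (f i).natDegree.lt_succ_self] at hi
  obtain ⟨b, -, hb⟩ := hP.prod_mem_iff.1 hi
  refine ⟨i, b, hP.mem_of_pow_mem _ hb, fun h0 => hP.ne_top ?_⟩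
  rw [h0, pow_zero] at hb
  exact P.eq_top_of_isUnit_mem hb isUnit_one

/-- Every monomial is of the form `Y^f`. -/
theorem exists_monom_eq_monomial (e : Fin n × ℕ →₀ ℕ) :
    ∃ f : Fin n → ℕ[X], MvPolynomial.monomial e (1 : K) = monom σK f := by
  induction e using Finsupp.induction_linear with
  | zero => exact ⟨0, by rw [monom_zero]; rfl⟩
  | add e e' h h' =>
    obtain ⟨f, hf⟩ := h
    obtain ⟨f', hf'⟩ := h'
    refine ⟨f + f', ?_⟩
    rw [monom_add, ← hf, ← hf', MvPolynomial.monomial_mul, one_mul]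
  | single v c =>
    refine ⟨Pi.single v.1 (monomial v.2 c), ?_⟩
    rw [monom, Finset.prod_eq_single v.1]
    · rw [Pi.single_eq_same, ypow_eq_prod σK _ _ (N := v.2 + 1)
        (Nat.lt_succ_of_le (natDegree_monomial_le c)), Finset.prod_eq_single v.2]
      · simp [MvPolynomial.X_pow_eq_monomial]
      · intro b _ hb
        simp [coeff_monomial, hb.symm]
      · simp
    · intro i _ hi
      rw [Pi.single_eq_of_ne hi, ypow_zero]
    · simp

end Monomials

section Binomials

variable {K : Type*} [Field K] {n : ℕ} (σK : K →+* K)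

theorem coeff_posPart (f : ℤ[X]) (k : ℕ) : (posPart f).coeff k = (f.coeff k).toNat := by
  rw [_root_.posPart, Polynomial.sum, finsetSum_coeff]
  simp only [coeff_monomial]
  rw [Finset.sum_ite_eq']
  split_ifs with h
  · rfl
  · simp [notMem_support_iff.1 h]

theorem coeff_negPart (f : ℤ[X]) (k : ℕ) : (negPart f).coeff k = (-f.coeff k).toNat := by
  rw [_root_.negPart, Polynomial.sum, finsetSum_coeff]
  simp only [coeff_monomial]
  rw [Finset.sum_ite_eq']
  split_ifs with h
  · rfl
  · simp [notMem_support_iff.1 h]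

/-- The vector of positive parts. -/
noncomputable def posVec (f : Fin n → ℤ[X]) (i : Fin n) : ℕ[X] := posPart (f i)

/-- The vector of negative parts. -/
noncomputable def negVec (f : Fin n → ℤ[X]) (i : Fin n) : ℕ[X] := negPart (f i)

theorem posVec_X_pow_mul (f : Fin n → ℤ[X]) (k : ℕ) :
    (posVec fun i => X ^ k * f i) = fun i => X ^ k * posVec f i := by
  ext i b
  simp only [posVec, coeff_posPart, coeff_X_pow_mul']
  split_ifs <;> simp

theorem negVec_X_pow_mul (f : Fin n → ℤ[X]) (k : ℕ) :
    (negVec fun i => X ^ k * f i) = fun i => X ^ k * negVec f i := by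
  ext i b
  simp only [negVec, coeff_negPart, coeff_X_pow_mul']
  split_ifs <;> simp

theorem posVec_neg (f : Fin n → ℤ[X]) : posVec (-f) = negVec f := by
  ext i b
  simp [posVec, negVec, coeff_posPart, coeff_negPart]

theorem negVec_neg (f : Fin n → ℤ[X]) : negVec (-f) = posVec f := by
  rw [← posVec_neg, neg_neg]

theorem posVec_add_add (f h : Fin n → ℤ[X]) :
    posVec (f + h) + (negVec f + negVec h) = negVec (f + h) + (posVec f + posVec h) := by
  ext i b
  simp only [posVec, negVec, Pi.add_apply, coeff_add, coeff_posPart, coeff_negPart]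
  omega

/-- The binomial `Y^{f_+} - Y^{f_-}`. -/
noncomputable def binom (f : Fin n → ℤ[X]) : DPoly K n :=
  monom σK (posVec f) - monom σK (negVec f)

theorem shift_iterate_binom (f : Fin n → ℤ[X]) (k : ℕ) :
    (⇑(shift σK))^[k] (binom σK f : DPoly K n) = binom σK fun i => X ^ k * f i := by
  rw [binom, iterate_map_sub, shift_iterate_monom, shift_iterate_monom, binom, posVec_X_pow_mul,
    negVec_X_pow_mul]

theorem binom_neg (f : Fin n → ℤ[X]) : (binom σK (-f) : DPoly K n) = -binom σK f := by
  rw [binom, binom, posVec_neg, negVec_neg, neg_sub]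

theorem binom_zero : (binom σK 0 : DPoly K n) = 0 := by
  have : posVec (0 : Fin n → ℤ[X]) = negVec 0 := by rw [← posVec_neg, neg_zero]
  rw [binom, this, sub_self]

/-- If `f` and `h` give binomials in `J`, then so does `f + h`, up to a monomial. -/
theorem monom_mul_binom_add_mem {J : Ideal (DPoly K n)} {f h : Fin n → ℤ[X]}
    (hf : binom σK f ∈ J) (hh : binom σK h ∈ J) :
    monom σK (negVec f + negVec h) * binom σK (f + h) ∈ J := by
  have key := congrArg (monom σK : _ → DPoly K n) (posVec_add_add f h)
  simp only [monom_add] at key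
  have : monom σK (negVec f + negVec h) * binom σK (f + h) =
      monom σK (negVec (f + h)) * monom σK (posVec h) * binom σK f +
        monom σK (negVec (f + h)) * monom σK (negVec f) * binom σK h := by
    simp only [binom, monom_add]
    linear_combination key
  rw [this]
  exact J.add_mem (J.mul_mem_left _ hf) (J.mul_mem_left _ hh)

/-- The binomials in a `σ`-stable prime form a pattern. -/
theorem isPattern_of_isPrime {P : Ideal (DPoly K n)} (hP : P.IsPrime)
    (hσ : IsSigmaIdeal (shift σK) P) :
    IsPattern (fun i b => (MvPolynomial.X (i, b) : DPoly K n) ∈ P) (fun f => binom σK f ∈ P) where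
  mono i b c hbc hb := by
    induction c, hbc using Nat.le_induction with
    | base => exact hb
    | succ c _ ih => simpa only [shift_X] using hσ _ ih
  zero := by
    rw [binom_zero]
    exact P.zero_mem
  neg f hf := by
    rw [binom_neg]
    exact P.neg_mem hf
  add f h hf hh hhZ := by
    by_cases hneg : monom σK (negVec f) ∈ P
    · have hpos : monom σK (posVec f) ∈ P := (P.sub_mem_iff_left hneg).1 hf
      obtain ⟨i, b, hX, hb⟩ := (monom_mem_iff σK hP _).1 hneg
      obtain ⟨i', b', hX', hb'⟩ := (monom_mem_iff σK hP _).1 hpos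
      refine P.sub_mem ((monom_mem_iff σK hP _).2 ⟨i', b', hX', ?_⟩)
        ((monom_mem_iff σK hP _).2 ⟨i, b, hX, ?_⟩)
      · simpa [posVec, coeff_posPart, hhZ i' b' hX'] using hb'
      · simpa [negVec, coeff_negPart, hhZ i b hX] using hb
    · refine (hP.mem_or_mem (monom_mul_binom_add_mem σK hf hh)).resolve_left fun hmem => ?_
      rw [monom_add] at hmem
      obtain ⟨i, b, hX, hb⟩ :=
        (monom_mem_iff σK hP _).1 ((hP.mem_or_mem hmem).resolve_left hneg)
      simp [negVec, coeff_negPart, hhZ i b hX] at hb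
  shift f k hf := by
    rw [← shift_iterate_binom]
    exact hσ.iterate_mem hf k
  avoids f hf hpos := by
    have hneg : monom σK (negVec f) ∉ P := fun hmem => by
      obtain ⟨i, b, hX, hb⟩ := (monom_mem_iff σK hP _).1 hmem
      have := hpos i b hX
      simp only [negVec, coeff_negPart] at hb
      omega
    intro i b hX
    by_contra h0
    refine hneg ((P.sub_mem_iff_right ((monom_mem_iff σK hP _).2 ⟨i, b, hX, ?_⟩)).1 hf)
    have := hpos i b hX
    simp only [posVec, coeff_posPart]
    omega
  signed f hf := by
    by_contra! hcon
    obtain ⟨⟨i, b, hX, hb⟩, i', b', hX', hb'⟩ := hcon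
    refine hf (P.sub_mem ((monom_mem_iff σK hP _).2 ⟨i', b', hX', ?_⟩)
      ((monom_mem_iff σK hP _).2 ⟨i, b, hX, ?_⟩))
    · simp only [posVec, coeff_posPart]
      omega
    · simp only [negVec, coeff_negPart]
      omega

end Binomials

section BinomialPart

variable {K τ : Type*} [Field K]

/-- The ideal generated by the pure binomials contained in `I`. -/
noncomputable def binomialPart (I : Ideal (MvPolynomial τ K)) : Ideal (MvPolynomial τ K) :=
  Ideal.span {p | p ∈ I ∧ ∃ u v, p = MvPolynomial.monomial u 1 - MvPolynomial.monomial v 1}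

/-- Congruence of exponents modulo `I`. -/
noncomputable def monomialCon (I : Ideal (MvPolynomial τ K)) : AddCon (τ →₀ ℕ) where
  r u v := (MvPolynomial.monomial u 1 - MvPolynomial.monomial v 1 : MvPolynomial τ K) ∈ I
  iseqv :=
    { refl u := by simp
      symm h := by simpa using I.neg_mem h
      trans h h' := by simpa using I.add_mem h h' }
  add' {u u' v v'} h h' := by
    have : (MvPolynomial.monomial (u + v) 1 - MvPolynomial.monomial (u' + v') 1 :
        MvPolynomial τ K) =
        MvPolynomial.monomial v 1 * (MvPolynomial.monomial u 1 - MvPolynomial.monomial u' 1) +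
          MvPolynomial.monomial u' 1 * (MvPolynomial.monomial v 1 - MvPolynomial.monomial v' 1) := by
      simp only [mul_sub, MvPolynomial.monomial_mul, one_mul, add_comm v]
      ring
    change (MvPolynomial.monomial (u + v) 1 - MvPolynomial.monomial (u' + v') 1 :
      MvPolynomial τ K) ∈ I
    rw [this]
    exact I.add_mem (I.mul_mem_left _ h) (I.mul_mem_left _ h')

theorem mem_binomialPart_iff (I : Ideal (MvPolynomial τ K)) (g : MvPolynomial τ K) :
    g ∈ binomialPart I ↔ AddMonoidAlgebra.mapDomainRingHom K (monomialCon I).mk' g = 0 := by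
  set π := AddMonoidAlgebra.mapDomainRingHom K (monomialCon I).mk'
  have hπ : ∀ u c, π (MvPolynomial.monomial u c) =
      AddMonoidAlgebra.single ((monomialCon I).mk' u) c :=
    fun u c => AddMonoidAlgebra.mapDomain_single
  constructor
  · suffices binomialPart I ≤ RingHom.ker π from fun h => this h
    refine Ideal.span_le.2 ?_
    rintro _ ⟨hp, u, v, rfl⟩
    have huv : (monomialCon I).mk' u = (monomialCon I).mk' v := (monomialCon I).eq.2 hp
    rw [SetLike.mem_coe, RingHom.mem_ker, map_sub, hπ, hπ, huv, sub_self]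
  · let s : AddMonoidAlgebra K (monomialCon I).Quotient → MvPolynomial τ K :=
      AddMonoidAlgebra.mapDomain Quotient.out
    have hs : ∀ g, g - s (π g) ∈ binomialPart I := fun g => by
      induction g using MvPolynomial.induction_on' with
      | monomial u c =>
        have h1 : s (π (MvPolynomial.monomial u c)) =
            MvPolynomial.monomial (Quotient.out ((monomialCon I).mk' u)) c := by
          rw [hπ]
          exact AddMonoidAlgebra.mapDomain_single
        set v := Quotient.out ((monomialCon I).mk' u)
        have huv : (MvPolynomial.monomial u 1 - MvPolynomial.monomial v 1 : MvPolynomial τ K) ∈ I :=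
          (monomialCon I).eq.1 (Quotient.out_eq ((monomialCon I).mk' u)).symm
        have h2 : MvPolynomial.monomial u c - MvPolynomial.monomial v c =
            MvPolynomial.C c *
              (MvPolynomial.monomial u 1 - MvPolynomial.monomial v 1 : MvPolynomial τ K) := by
          simp [mul_sub, MvPolynomial.C_mul_monomial]
        rw [h1, h2]
        exact Ideal.mul_mem_left _ _ (Ideal.subset_span ⟨huv, u, v, rfl⟩)
      | add p q hp hq =>
        have h : s (π (p + q)) = s (π p) + s (π q) := by
          rw [map_add]
          exact AddMonoidAlgebra.mapDomain_add _ _ _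
        rw [h, add_sub_add_comm]
        exact Ideal.add_mem _ hp hq
    intro hg
    have h0 : s 0 = 0 := AddMonoidAlgebra.mapDomain_zero _
    simpa [hg, h0] using hs g

/-- Monomials cancelling from the pure binomials of `I` cancel from all of `binomialPart I`. -/
theorem mem_binomialPart_of_monomial_mul_mem {I : Ideal (MvPolynomial τ K)} {w : τ →₀ ℕ}
    (hw : ∀ u v,
      MvPolynomial.monomial w 1 * (MvPolynomial.monomial u 1 - MvPolynomial.monomial v 1) ∈ I →
      (MvPolynomial.monomial u 1 - MvPolynomial.monomial v 1 : MvPolynomial τ K) ∈ I)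
    {g : MvPolynomial τ K} (hg : MvPolynomial.monomial w 1 * g ∈ binomialPart I) :
    g ∈ binomialPart I := by
  rw [mem_binomialPart_iff, map_mul] at hg
  rw [mem_binomialPart_iff]
  have hsingle : AddMonoidAlgebra.mapDomainRingHom K (monomialCon I).mk'
      (MvPolynomial.monomial w 1 : MvPolynomial τ K) =
        AddMonoidAlgebra.single ((monomialCon I).mk' w) 1 :=
    AddMonoidAlgebra.mapDomain_single
  rw [hsingle] at hg
  ext q
  have hcancel : ∀ q q' : (monomialCon I).Quotient,
      (monomialCon I).mk' w + q = (monomialCon I).mk' w + q' → q = q' := by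
    rintro ⟨u⟩ ⟨v⟩ h
    refine (monomialCon I).eq.2 (hw u v ?_)
    rw [mul_sub, MvPolynomial.monomial_mul, MvPolynomial.monomial_mul, one_mul]
    exact (monomialCon I).eq.1 h
  rw [← one_mul ((AddMonoidAlgebra.mapDomainRingHom K (monomialCon I).mk' g).coeff q),
    ← AddMonoidAlgebra.coeff_single_mul_eq_mul_coeff (m := (monomialCon I).mk' w)
      (m₁ := (monomialCon I).mk' w + q) q fun q' _ => ⟨hcancel q' q, fun h => h ▸ rfl⟩, hg]
  rfl

end BinomialPart

section Saturation

variable {K : Type*} [Field K] {n t : ℕ} (σK : K →+* K) (j : Fin t → Fin n) (a : Fin t → ℕ)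

/-- The exponents occurring in `[y_{j_1}^{x^{a_1}},…,y_{j_t}^{x^{a_t}}]`. -/
def Beyond (i : Fin n) (b : ℕ) : Prop := ∃ m, i = j m ∧ a m ≤ b

variable {j a}

theorem avoids_beyond_iff {u : Fin n → ℕ[X]} :
    Avoids (Beyond j a) u ↔ ∀ m, (u (j m)).degree < (a m : WithBot ℕ) := by
  simp only [degree_lt_iff_coeff_zero]
  exact ⟨fun h m b hb => h _ b ⟨m, rfl, hb⟩, fun h i b ⟨m, hi, hb⟩ => hi ▸ h m b hb⟩

theorem Avoids.monom_mem_Tset {u : Fin n → ℕ[X]} (hu : Avoids (Beyond j a) u) :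
    (monom σK u : DPoly K n) ∈ Tset σK j a :=
  ⟨u, avoids_beyond_iff.1 hu, rfl⟩

theorem mem_Tset_iff {M : DPoly K n} :
    M ∈ Tset σK j a ↔ ∃ u, Avoids (Beyond j a) u ∧ M = monom σK u := by
  simp only [avoids_beyond_iff]
  rfl

theorem exists_monomial_eq_monom (u : Fin n → ℕ[X]) :
    ∃ e, (monom σK u : DPoly K n) = MvPolynomial.monomial e 1 := by
  suffices (monom σK u : DPoly K n) ∈
      MonoidHom.mrange (MvPolynomial.monomialOneHom K (Fin n × ℕ)) from
    this.elim fun e he => ⟨e.toAdd, he.symm⟩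
  refine Submonoid.prod_mem _ fun i _ => ?_
  rw [ypow_eq_prod σK i _ (u i).natDegree.lt_succ_self]
  exact Submonoid.prod_mem _ fun k _ => Submonoid.pow_mem _
    (MonoidHom.mem_mrange.2 ⟨Multiplicative.ofAdd (Finsupp.single (i, k) 1), rfl⟩) _

theorem binomialPart_isSigmaIdeal {J : Ideal (DPoly K n)} (hσ : IsSigmaIdeal (shift σK) J) :
    IsSigmaIdeal (shift σK) (binomialPart J) := by
  suffices binomialPart J ≤ (binomialPart J).comap (shift σK) from fun x hx => this hx
  refine Ideal.span_le.2 ?_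
  rintro _ ⟨hp, u, v, rfl⟩
  refine Ideal.subset_span ⟨hσ _ hp, ?_⟩
  obtain ⟨f, hf⟩ := exists_monom_eq_monomial (K := K) σK u
  obtain ⟨g, hg⟩ := exists_monom_eq_monomial (K := K) σK v
  obtain ⟨u', hu'⟩ := exists_monomial_eq_monom σK fun i => X * f i
  obtain ⟨v', hv'⟩ := exists_monomial_eq_monom σK fun i => X * g i
  exact ⟨u', v', by rw [map_sub, hf, hg, shift_monom, shift_monom, hu', hv']⟩

theorem SaturatedWrt.binomialPart {J : Ideal (DPoly K n)} (hsat : SaturatedWrt σK j a J) :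
    SaturatedWrt σK j a (binomialPart J) := by
  rintro g M hM hg
  obtain ⟨w, hw, rfl⟩ := (mem_Tset_iff σK).1 hM
  obtain ⟨e, he⟩ := exists_monomial_eq_monom σK w
  rw [he] at hg hM
  exact mem_binomialPart_of_monomial_mul_mem (fun u v => hsat _ _ hM) hg

theorem le_Nclosure (I : Ideal (DPoly K n)) : I ≤ Nclosure σK j a I :=
  le_sInf fun _ hJ => hJ.1

theorem Nclosure_isSigmaIdeal (I : Ideal (DPoly K n)) :
    IsSigmaIdeal (shift σK) (Nclosure σK j a I) := fun x hx =>
  Submodule.mem_sInf.2 fun _ hJ => hJ.2.1 x (Submodule.mem_sInf.1 hx _ hJ)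

theorem Nclosure_saturated (I : Ideal (DPoly K n)) : SaturatedWrt σK j a (Nclosure σK j a I) :=
  fun g M hM hx =>
  Submodule.mem_sInf.2 fun _ hJ => hJ.2.2 g M hM (Submodule.mem_sInf.1 hx _ hJ)

/-- The saturated closure of a pure binomial `σ`-ideal is generated by pure binomials. -/
theorem Nclosure_le_binomialPart {I : Ideal (DPoly K n)} (hI : IsPureBinomialSigmaIdeal σK I) :
    Nclosure σK j a I ≤ binomialPart (Nclosure σK j a I) := by
  have hσ := binomialPart_isSigmaIdeal σK (Nclosure_isSigmaIdeal σK (j := j) (a := a) I)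
  refine sInf_le ⟨?_, hσ, (Nclosure_saturated σK I).binomialPart⟩
  obtain ⟨S, hS, hIS⟩ := hI
  conv_lhs => rw [hIS]
  refine sInf_le ⟨fun p hp => Ideal.subset_span ⟨le_Nclosure σK I ?_, ?_⟩, hσ⟩
  · rw [hIS]
    exact subset_sigmaIdealGen _ _ hp
  · obtain ⟨f, g, rfl⟩ := hS p hp
    obtain ⟨u, hu⟩ := exists_monomial_eq_monom σK f
    obtain ⟨v, hv⟩ := exists_monomial_eq_monom σK g
    exact ⟨u, v, by rw [hu, hv]⟩

theorem Avoids.zero {Z : Fin n → ℕ → Prop} : Avoids Z (0 : Fin n → ℕ[X]) := fun _ _ _ => rfl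

theorem Avoids.add {Z : Fin n → ℕ → Prop} {u v : Fin n → ℕ[X]} (hu : Avoids Z u)
    (hv : Avoids Z v) : Avoids Z (u + v) := fun i b hb => by
  simp [hu i b hb, hv i b hb]

/-- `A : T` as an ideal. -/
def colonTIdeal (j : Fin t → Fin n) (a : Fin t → ℕ) (A : Ideal (DPoly K n)) :
    Ideal (DPoly K n) where
  carrier := colonT σK j a A
  zero_mem' := ⟨_, Avoids.zero.monom_mem_Tset σK, by simp⟩
  add_mem' := by
    rintro x y ⟨M, hM, hx⟩ ⟨N, hN, hy⟩
    obtain ⟨u, hu, rfl⟩ := (mem_Tset_iff σK).1 hM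
    obtain ⟨v, hv, rfl⟩ := (mem_Tset_iff σK).1 hN
    refine ⟨_, (hu.add hv).monom_mem_Tset σK, ?_⟩
    have : monom σK (u + v) * (x + y) =
        monom σK v * (monom σK u * x) + monom σK u * (monom σK v * y) := by
      rw [monom_add]
      ring
    rw [this]
    exact A.add_mem (A.mul_mem_left _ hx) (A.mul_mem_left _ hy)
  smul_mem' := by
    rintro c x ⟨M, hM, hx⟩
    exact ⟨M, hM, by simpa only [smul_eq_mul, mul_left_comm] using A.mul_mem_left c hx⟩

/-- Elements of the saturated closure of `I` are multiplied by monomials in `T` into every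
well-mixed ideal containing `I`. -/
theorem exists_monom_mul_mem_of_mem_Nclosure {I A : Ideal (DPoly K n)}
    (hA : IsWellMixed (shift σK) A) (hIA : I ≤ A) {g : DPoly K n} (hg : g ∈ Nclosure σK j a I) :
    ∃ w, Avoids (Beyond j a) w ∧ monom σK w * g ∈ A := by
  suffices Nclosure σK j a I ≤ colonTIdeal σK j a A by
    obtain ⟨M, hM, h⟩ := this hg
    obtain ⟨w, hw, rfl⟩ := (mem_Tset_iff σK).1 hM
    exact ⟨w, hw, h⟩
  refine sInf_le ⟨fun x hx => ?_, ?_, ?_⟩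
  · exact ⟨_, Avoids.zero.monom_mem_Tset σK, A.mul_mem_left _ (hIA hx)⟩
  · rintro x ⟨M, hM, hx⟩
    exact ⟨M, hM, hA _ _ hx⟩
  · rintro x M hM ⟨N, hN, hx⟩
    obtain ⟨u, hu, rfl⟩ := (mem_Tset_iff σK).1 hM
    obtain ⟨v, hv, rfl⟩ := (mem_Tset_iff σK).1 hN
    exact ⟨_, (hv.add hu).monom_mem_Tset σK, by rwa [monom_add, mul_assoc]⟩

theorem Avoids.negVec {Z : Fin n → ℕ → Prop} {f : Fin n → ℤ[X]} (hf : Avoids Z f) :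
    Avoids Z (negVec f) := fun i b hb => by
  simp [_root_.negVec, coeff_negPart, hf i b hb]

/-- The exponents of degree bounded by `a` whose binomials lie in a saturated ideal. -/
def boundedLattice {J : Ideal (DPoly K n)} (hJ : SaturatedWrt σK j a J) :
    AddSubgroup (Fin n → ℤ[X]) where
  carrier := {f | Avoids (Beyond j a) f ∧ binom σK f ∈ J}
  zero_mem' := ⟨fun _ _ _ => rfl, by simp [binom_zero]⟩
  add_mem' := fun {f h} hf hh => ⟨fun i b hb => by simp [hf.1 i b hb, hh.1 i b hb],
    hJ _ _ ((hf.1.negVec.add hh.1.negVec).monom_mem_Tset σK)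
      (monom_mul_binom_add_mem σK hf.2 hh.2)⟩
  neg_mem' := fun {f} hf => ⟨fun i b hb => by simp [hf.1 i b hb], by
    rw [binom_neg]
    exact J.neg_mem hf.2⟩

/-- Two exponent vectors differ by the positive and negative parts of a common difference. -/
theorem exists_eq_posVec_add {Z : Fin n → ℕ → Prop} {u v : Fin n → ℕ[X]} (hu : Avoids Z u)
    (hv : Avoids Z v) : ∃ (f : Fin n → ℤ[X]) (w : Fin n → ℕ[X]), Avoids Z f ∧ Avoids Z w ∧
      u = w + posVec f ∧ v = w + negVec f := by
  have hw : ∀ i k, ((u i).sum fun k c => monomial k (min c ((v i).coeff k))).coeff k =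
      min ((u i).coeff k) ((v i).coeff k) := fun i k => by
    rw [Polynomial.sum, finsetSum_coeff]
    simp only [coeff_monomial]
    rw [Finset.sum_ite_eq']
    split_ifs with h
    · rfl
    · simp [notMem_support_iff.1 h]
  refine ⟨fun i => (u i).map (Nat.castRingHom ℤ) - (v i).map (Nat.castRingHom ℤ),
    fun i => (u i).sum fun k c => monomial k (min c ((v i).coeff k)), fun i b hb => ?_,
    fun i b hb => ?_, ?_, ?_⟩
  · simp [hu i b hb, hv i b hb]
  · rw [hw, hu i b hb, hv i b hb, min_self]
  · ext i k
    simp only [Pi.add_apply, coeff_add, hw, posVec, coeff_posPart, coeff_sub, coeff_map,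
      Nat.coe_castRingHom]
    omega
  · ext i k
    simp only [Pi.add_apply, coeff_add, hw, negVec, coeff_negPart, coeff_sub, coeff_map,
      Nat.coe_castRingHom]
    omega

theorem varSet_subset_iff {P : Ideal (DPoly K n)} (hσ : IsSigmaIdeal (shift σK) P) :
    varSet σK j a ⊆ P ↔ ∀ i b, Beyond j a i b → (MvPolynomial.X (i, b) : DPoly K n) ∈ P := by
  constructor
  · rintro h _ b ⟨m, rfl, hb⟩
    induction b, hb using Nat.le_induction with
    | base =>
      rw [← varPow_eq_X σK]
      exact h ⟨m, rfl⟩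
    | succ c _ ih => simpa only [shift_X] using hσ _ ih
  · rintro h _ ⟨m, rfl⟩
    change varPow σK (j m) (a m) ∈ P
    rw [varPow_eq_X]
    exact h _ _ ⟨m, rfl, le_rfl⟩

theorem monom_mem_sigmaIdealGen_varSet {u : Fin n → ℕ[X]} (hu : ¬Avoids (Beyond j a) u) :
    (monom σK u : DPoly K n) ∈ sigmaIdealGen (shift σK) (varSet σK j a) := by
  simp only [Avoids, not_forall] at hu
  obtain ⟨i, b, hb, hne⟩ := hu
  exact Submodule.mem_sInf.2 fun Q hQ =>
    Ideal.mem_of_dvd _ (X_dvd_monom σK hne) ((varSet_subset_iff σK hQ.2).1 hQ.1 i b hb)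

/-- Under quasi-normality, a `σ`-stable prime containing the variables contains `I₀` as soon as it
contains the binomials of bounded degree. -/
theorem QuasiNormal.le_of_boundedLattice {I0 P : Ideal (DPoly K n)} (h0 : QuasiNormal σK j a I0)
    (hI0 : I0 ≤ binomialPart I0) (hσ : IsSigmaIdeal (shift σK) P) (hV : varSet σK j a ⊆ P)
    (hL : ∀ f ∈ boundedLattice σK h0.1, binom σK f ∈ P) : I0 ≤ P := by
  refine hI0.trans (Ideal.span_le.2 ?_)
  rintro _ ⟨hp, e, e', rfl⟩
  obtain ⟨u, hu⟩ := exists_monom_eq_monomial (K := K) σK e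
  obtain ⟨v, hv⟩ := exists_monom_eq_monomial (K := K) σK e'
  rw [hu, hv] at hp ⊢
  have hVP : sigmaIdealGen (shift σK) (varSet σK j a) ≤ P := sInf_le ⟨hV, hσ⟩
  by_cases hTu : Avoids (Beyond j a) u
  · by_cases hTv : Avoids (Beyond j a) v
    · obtain ⟨f, w, hf, hw, rfl, rfl⟩ := exists_eq_posVec_add hTu hTv
      have hmul : monom σK (w + posVec f) - monom σK (w + negVec f) =
          (monom σK w * binom σK f : DPoly K n) := by
        rw [monom_add, monom_add, binom, mul_sub]
      rw [hmul] at hp ⊢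
      exact P.mul_mem_left _ (hL f ⟨hf, h0.1 _ _ (hw.monom_mem_Tset σK) hp⟩)
    · have h := monom_mem_sigmaIdealGen_varSet σK hTv
      exact P.sub_mem (hVP (h0.2 v u (by simpa using I0.neg_mem hp) h)) (hVP h)
  · have h := monom_mem_sigmaIdealGen_varSet σK hTu
    exact P.sub_mem (hVP h) (hVP (h0.2 u v hp h))

end Saturation

/-- If `⟨N(I) ∪ {vars}⟩_r` is quasi-normal, then `⟨I ∪ {vars}⟩_r` decomposes as
`⟨N(I) ∪ {vars}⟩_r ∩ ⋂_k ⟨I ∪ {vars} ∪ {y_{p_k}^{x^{b_k}}}⟩_r`. -/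
theorem stmt7 {K : Type*} [Field K] [CharZero K] {n t : ℕ} (σK : K →+* K)
    (j : Fin t → Fin n) (hj : Function.Injective j) (a : Fin t → ℕ)
    (I : Ideal (DPoly K n)) (hI : IsPureBinomialSigmaIdeal σK I)
    (hqn : QuasiNormal σK j a (Nclosure σK j a I)) :
    ∃ (l : ℕ) (p : Fin l → Fin n) (b : Fin l → ℕ),
      (∀ k : Fin l, (∀ m : Fin t, p k ≠ j m) ∨ ∃ m : Fin t, p k = j m ∧ b k < a m) ∧
      rwmClosure (shift σK) ((I : Set (DPoly K n)) ∪ varSet σK j a) =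
        rwmClosure (shift σK) ((Nclosure σK j a I : Set (DPoly K n)) ∪ varSet σK j a) ⊓
          ⨅ k : Fin l, rwmClosure (shift σK)
            ((I : Set (DPoly K n)) ∪ varSet σK j a ∪ {varPow σK (p k) (b k)}) := by
  obtain ⟨G, hGL, hG⟩ := exists_finite_determining_set
    (ι := {P : Ideal (DPoly K n) // P.IsPrime ∧ IsSigmaIdeal (shift σK) P ∧ varSet σK j a ⊆ P})
    (fun P i b => (MvPolynomial.X (i, b) : DPoly K n) ∈ P.1) (fun P f => binom σK f ∈ P.1)
    (fun P => isPattern_of_isPrime σK P.2.1 P.2.2.1) (boundedLattice σK hqn.1)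
    fun P f hf k hk => ⟨fun i b hb => hk i b ((varSet_subset_iff σK P.2.2.1).1 P.2.2.2 i b hb), by
      rw [← shift_iterate_binom]
      exact (Nclosure_isSigmaIdeal σK I).iterate_mem hf.2 k⟩
  set A := rwmClosure (shift σK) ((I : Set (DPoly K n)) ∪ varSet σK j a)
  have hIA : I ≤ A := fun x hx => subset_rwmClosure _ _ (Or.inl hx)
  have hw : ∀ g : Fin n → ℤ[X], ∃ w, g ∈ G → Avoids (Beyond j a) w ∧
      monom σK w * binom σK g ∈ A := fun g => by
    by_cases hg : g ∈ G
    · obtain ⟨w, hw⟩ := exists_monom_mul_mem_of_mem_Nclosure σK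
        (rwmClosure_isWellMixed _ _) hIA (hGL hg).2
      exact ⟨w, fun _ => hw⟩
    · exact ⟨0, fun h => absurd h hg⟩
  choose w hw using hw
  let W : Finset (Fin n × ℕ) :=
    G.biUnion fun g => Finset.univ.biUnion fun i => (w g i).support.image (Prod.mk i)
  have hW : ∀ i b, (i, b) ∈ W ↔ ∃ g ∈ G, (w g i).coeff b ≠ 0 := by simp [W]
  let e := W.equivFin.symm
  refine ⟨W.card, fun k => (e k).1.1, fun k => (e k).1.2, fun k => ?_, le_antisymm ?_ ?_⟩
  · obtain ⟨g, hg, hb⟩ := (hW (e k).1.1 (e k).1.2).1 (e k).2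
    by_contra! hcon
    obtain ⟨⟨m, hm⟩, hk⟩ := hcon
    exact hb ((hw g hg).1 _ _ ⟨m, hm, hk m hm⟩)
  · refine le_inf (rwmClosure_mono _ ?_) (le_iInf fun k => rwmClosure_mono _ ?_)
    · exact (Set.union_subset_union_left _ (le_Nclosure σK I)).trans (subset_rwmClosure _ _)
    · exact Set.subset_union_left.trans (subset_rwmClosure _ _)
  · rintro x ⟨hx, hxk⟩
    refine mem_rwmClosure_of_forall_isPrime _ fun P hP hσ hIV => ?_
    by_cases hWP : ∃ q ∈ W, (MvPolynomial.X q : DPoly K n) ∈ P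
    · obtain ⟨q, hq, hqP⟩ := hWP
      refine rwmClosure_le_of_isPrime _ hP hσ (Set.union_subset hIV ?_)
        ((Submodule.mem_iInf _).1 hxk (e.symm ⟨q, hq⟩))
      simpa [varPow_eq_X] using hqP
    · have hV := Set.subset_union_right.trans hIV
      have hGP : ∀ g ∈ G, binom σK g ∈ P := fun g hg => by
        refine (hP.mem_or_mem
          (rwmClosure_le_of_isPrime _ hP hσ hIV (hw g hg).2)).resolve_left fun hmem => ?_
        obtain ⟨i, b, hX, hb⟩ := (monom_mem_iff σK hP _).1 hmem
        exact hWP ⟨(i, b), (hW i b).2 ⟨g, hg, hb⟩, hX⟩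
      exact rwmClosure_le_of_isPrime _ hP hσ (Set.union_subset (hqn.le_of_boundedLattice σK
        (Nclosure_le_binomialPart σK hI) hσ hV (hG ⟨P, hP, hσ, hV⟩ hGP)) hV) hx
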